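/- In ℝ⁹ with standard basis e₁,…,e₉ and the linear map φ given by φ(eᵢ) = −e_{i+4}, φ(e_{i+4}) = eᵢ (1 ≤ i ≤ 4), φ(e₉) = 0, fix θ₀ ∈ (0, π/2), u₂, u₄, z ∈ ℝ, define Y₁ = e₁ + u₂e₉, Y₂ = e₅, Y₃ = e₃ + (u₄ cos θ₀)e₉, Y₄ = (cos θ₀)e₇ + (sin θ₀)e₈, Y₅ = e₉, and equip ℝ⁹ with the inner product B(u, v) = e^{2z} Σ_{i=1}^{8} uᵢvᵢ + u₉v₉ (the warped product metric dz² + e^{2z}⟨·,·⟩ at height z). Let T = span{Y₁,…,Y₅} and let π be the B-orthogonal projection onto T. Then π(φe₃) = −(cos θ₀)Y₄ and π(φY₄) = (cos θ₀)e₃, and for every nonzero Z ∈ span{e₃, Y₄}: ‖π(φZ)‖_B = (cos θ₀)‖φZ‖_B. Hence span{e₃, Y₄} is a slant subspace of T with slant angle θ₀. -/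

import Mathlib

open scoped InnerProductSpace RealInnerProductSpace

/-- The orthogonal projection of `u` onto a submodule with respect to the warped inner product `B`
is unique. -/
theorem eq_of_warped_orthogonal (z : ℝ)
    (B : EuclideanSpace ℝ (Fin 9) → EuclideanSpace ℝ (Fin 9) → ℝ)
    (hB : ∀ u v, B u v =
      Real.exp (2 * z) * (∑ i : Fin 8, u i.castSucc * v i.castSucc) + u 8 * v 8)
    (T : Submodule ℝ (EuclideanSpace ℝ (Fin 9))) {u p q : EuclideanSpace ℝ (Fin 9)}
    (hp : p ∈ T) (hq : q ∈ T) (hup : ∀ w ∈ T, B (u - p) w = 0)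
    (huq : ∀ w ∈ T, B (u - q) w = 0) : p = q := by
  have hsub : B (p - q) (p - q) = 0 := by
    have h : B (p - q) (p - q) = B (u - q) (p - q) - B (u - p) (p - q) := by
      simp only [hB, PiLp.sub_apply, Fin.sum_univ_eight]
      ring
    rw [h, hup _ (T.sub_mem hp hq), huq _ (T.sub_mem hp hq), sub_zero]
  rw [hB] at hsub
  have hexp := Real.exp_pos (2 * z)
  have hsum : 0 ≤ ∑ i : Fin 8, (p - q) i.castSucc * (p - q) i.castSucc :=
    Finset.sum_nonneg fun i _ => mul_self_nonneg _
  obtain ⟨h₁, h₂⟩ := (add_eq_zero_iff_of_nonneg (mul_nonneg hexp.le hsum)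
    (mul_self_nonneg _)).1 hsub
  have h₃ := (Finset.sum_eq_zero_iff_of_nonneg fun i _ => mul_self_nonneg _).1
    ((mul_eq_zero.1 h₁).resolve_left hexp.ne')
  rw [← sub_eq_zero]
  ext i
  refine Fin.lastCases ?_ (fun j => ?_) i
  · exact mul_self_eq_zero.1 h₂
  · exact mul_self_eq_zero.1 (h₃ j (Finset.mem_univ j))

/-- Example 2: with respect to the warped product metric
`B(u,v) = e^{2z} Σ_{i=1}^{8} uᵢvᵢ + u₉v₉` on `ℝ⁹` and the `B`-orthogonal projection
`π` onto `T = span{Y₁,…,Y₅}`, one has `π(φe₃) = −cos θ₀ · Y₄`,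
`π(φY₄) = cos θ₀ · e₃`, and `‖π(φZ)‖_B = cos θ₀ ‖φZ‖_B` for all nonzero
`Z ∈ span{e₃, Y₄}`; i.e. `span{e₃, Y₄}` is slant in `T` with slant angle `θ₀`.
(Indices: `e 2 = ∂/∂x₃`, `e 6 = ∂/∂y₃`, `e 7 = ∂/∂y₄`, `e 8 = ∂/∂z`.) -/
theorem example2_slant_distribution
    (e : Fin 9 → EuclideanSpace ℝ (Fin 9))
    (he : ∀ i, e i = EuclideanSpace.single i (1 : ℝ))
    (φ : EuclideanSpace ℝ (Fin 9) →ₗ[ℝ] EuclideanSpace ℝ (Fin 9))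
    (hφ0 : φ (e 0) = -e 4) (hφ1 : φ (e 1) = -e 5)
    (hφ2 : φ (e 2) = -e 6) (hφ3 : φ (e 3) = -e 7)
    (hφ4 : φ (e 4) = e 0) (hφ5 : φ (e 5) = e 1)
    (hφ6 : φ (e 6) = e 2) (hφ7 : φ (e 7) = e 3)
    (hφ8 : φ (e 8) = 0)
    (θ₀ : ℝ) (hθ₀ : θ₀ ∈ Set.Ioo 0 (Real.pi / 2))
    (u₂ u₄ z : ℝ)
    (Y₁ Y₂ Y₃ Y₄ Y₅ : EuclideanSpace ℝ (Fin 9))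
    (hY₁ : Y₁ = e 0 + u₂ • e 8)
    (hY₂ : Y₂ = e 4)
    (hY₃ : Y₃ = e 2 + (u₄ * Real.cos θ₀) • e 8)
    (hY₄ : Y₄ = (Real.cos θ₀) • e 6 + (Real.sin θ₀) • e 7)
    (hY₅ : Y₅ = e 8)
    (B : EuclideanSpace ℝ (Fin 9) → EuclideanSpace ℝ (Fin 9) → ℝ)
    (hB : ∀ u v, B u v =
      Real.exp (2 * z) * (∑ i : Fin 8, u i.castSucc * v i.castSucc) + u 8 * v 8)
    (T : Submodule ℝ (EuclideanSpace ℝ (Fin 9)))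
    (hT : T = Submodule.span ℝ {Y₁, Y₂, Y₃, Y₄, Y₅})
    (π : EuclideanSpace ℝ (Fin 9) → EuclideanSpace ℝ (Fin 9))
    (hπmem : ∀ u, π u ∈ T)
    (hπorth : ∀ u, ∀ w ∈ T, B (u - π u) w = 0) :
    π (φ (e 2)) = -(Real.cos θ₀) • Y₄ ∧
    π (φ Y₄) = (Real.cos θ₀) • e 2 ∧
    (∀ Z ∈ Submodule.span ℝ {e 2, Y₄}, Z ≠ 0 →
      Real.sqrt (B (π (φ Z)) (π (φ Z))) = Real.cos θ₀ * Real.sqrt (B (φ Z) (φ Z))) := by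
  have hsc := Real.sin_sq_add_cos_sq θ₀
  have hcos : 0 ≤ Real.cos θ₀ :=
    Real.cos_nonneg_of_mem_Icc ⟨by linarith [hθ₀.1, Real.pi_pos], hθ₀.2.le⟩
  set c := Real.cos θ₀
  set s := Real.sin θ₀
  have hY₄T : Y₄ ∈ T := hT ▸ Submodule.subset_span (by simp)
  have he₂T : e 2 ∈ T := by
    have h : e 2 = Y₃ - (u₄ * c) • Y₅ := by rw [hY₃, hY₅]; abel
    rw [h, hT]
    exact Submodule.sub_mem _ (Submodule.subset_span (by simp))
      (Submodule.smul_mem _ _ (Submodule.subset_span (by simp)))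
  have hTcoord : ∀ w ∈ T, w 3 = 0 ∧ s * w 6 = c * w 7 := by
    intro w hw
    rw [hT] at hw
    induction hw using Submodule.span_induction with
    | mem x hx =>
      simp only [Set.mem_insert_iff, Set.mem_singleton_iff] at hx
      rcases hx with rfl | rfl | rfl | rfl | rfl <;>
        simp [hY₁, hY₂, hY₃, hY₄, hY₅, he, mul_comm]
    | zero => simp
    | add x y _ _ hx hy =>
      simp only [PiLp.add_apply, mul_add]
      exact ⟨by rw [hx.1, hy.1, add_zero], by rw [hx.2, hy.2]⟩
    | smul a x _ hx =>
      simp only [PiLp.smul_apply, smul_eq_mul]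
      exact ⟨by rw [hx.1, mul_zero], by linear_combination a * hx.2⟩
  have hφZ : ∀ a b : ℝ, φ (a • e 2 + b • Y₄) = -a • e 6 + (b * c) • e 2 + (b * s) • e 3 := by
    intro a b
    simp only [hY₄, map_add, map_smul, hφ2, hφ6, hφ7]
    module
  have hπφ : ∀ a b : ℝ, π (φ (a • e 2 + b • Y₄)) = (-a * c) • Y₄ + (b * c) • e 2 := by
    intro a b
    refine eq_of_warped_orthogonal z B hB T (hπmem _)
      (T.add_mem (T.smul_mem _ hY₄T) (T.smul_mem _ he₂T)) (hπorth _) fun w hw => ?_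
    obtain ⟨h₃, h₆₇⟩ := hTcoord w hw
    rw [hφZ, hB]
    simp [hY₄, he, Fin.sum_univ_eight, h₃]
    linear_combination (-a * s) * h₆₇ + a * w 6 * hsc
  refine ⟨?_, ?_, fun Z hZ _ => ?_⟩
  · simpa using hπφ 1 0
  · simpa using hπφ 0 1
  · obtain ⟨a, b, rfl⟩ := Submodule.mem_span_pair.1 hZ
    have hnorm : B (π (φ (a • e 2 + b • Y₄))) (π (φ (a • e 2 + b • Y₄))) =
        c ^ 2 * B (φ (a • e 2 + b • Y₄)) (φ (a • e 2 + b • Y₄)) := by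
      rw [hπφ, hφZ, hB, hB]
      simp [hY₄, he, Fin.sum_univ_eight]
      linear_combination Real.exp (2 * z) * c ^ 2 * (a ^ 2 - b ^ 2) * hsc
    rw [hnorm, Real.sqrt_mul (sq_nonneg c), Real.sqrt_sq hcos]
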